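/- For all real numbers μ and δ with 0 < μ < 1/2 and 1/6 < δ < 1/2, there exist real numbers ε₁ > 0, ε₂ > 0 and d > 0 such that the random graph sequence G = G_n is, with probability tending to 1 as n → ∞, robust against the iterative strong adversary but not robust against the non-iterative strong adversary. -/

import Mathlib

open MeasureTheory Filter

namespace AdversarialOpinion

/-! ### Block structure on `Fin n`

The vertex set `Fin n` is split into five consecutive blocks
`I, J, O, P, D` of sizes `nI, nJ, nO, nP` and `n - (nI+nJ+nO+nP)`. -/

/-- `v` lies in the block `I`. -/
abbrev InI (nI : ℕ) {n : ℕ} (v : Fin n) : Prop := (v : ℕ) < nI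

/-- `v` lies in the block `J`. -/
abbrev InJ (nI nJ : ℕ) {n : ℕ} (v : Fin n) : Prop :=
  nI ≤ (v : ℕ) ∧ (v : ℕ) < nI + nJ

/-- `v` lies in the block `O`. -/
abbrev InO (nI nJ nO : ℕ) {n : ℕ} (v : Fin n) : Prop :=
  nI + nJ ≤ (v : ℕ) ∧ (v : ℕ) < nI + nJ + nO

/-- `v` lies in the block `P`. -/
abbrev InP (nI nJ nO nP : ℕ) {n : ℕ} (v : Fin n) : Prop :=
  nI + nJ + nO ≤ (v : ℕ) ∧ (v : ℕ) < nI + nJ + nO + nP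

/-- `v` lies in the block `D`. -/
abbrev InD (nI nJ nO nP : ℕ) {n : ℕ} (v : Fin n) : Prop :=
  nI + nJ + nO + nP ≤ (v : ℕ)

/-- The block `I` as a finite set. -/
def Iset (nI : ℕ) (n : ℕ) : Finset (Fin n) := Finset.univ.filter fun v => InI nI v

/-- The block `J` as a finite set. -/
def Jset (nI nJ : ℕ) (n : ℕ) : Finset (Fin n) := Finset.univ.filter fun v => InJ nI nJ v

/-- The block `O` as a finite set. -/
def Oset (nI nJ nO : ℕ) (n : ℕ) : Finset (Fin n) := Finset.univ.filter fun v => InO nI nJ nO v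

/-- The block `P` as a finite set. -/
def Pset (nI nJ nO nP : ℕ) (n : ℕ) : Finset (Fin n) :=
  Finset.univ.filter fun v => InP nI nJ nO nP v

/-- The block `D` as a finite set. -/
def Dset (nI nJ nO nP : ℕ) (n : ℕ) : Finset (Fin n) :=
  Finset.univ.filter fun v => InD nI nJ nO nP v

/-! ### The random graph `G` -/

/-- Unsymmetrized adjacency: `I`, `J`, `P` are cliques, `O` is joined to all of
`V \ D`, the pairs `I–J`, `J–P`, `I–P` are joined according to the random bits
`ω`, and the `k`-th vertex of `D` is matched to the `k`-th vertex of `J`. -/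
def Rel (nI nJ nO nP : ℕ) {n : ℕ} (ω : Fin n → Fin n → Bool) (v w : Fin n) : Prop :=
  (InI nI v ∧ InI nI w) ∨
  (InJ nI nJ v ∧ InJ nI nJ w) ∨
  (InP nI nJ nO nP v ∧ InP nI nJ nO nP w) ∨
  (InO nI nJ nO v ∧ ¬ InD nI nJ nO nP w) ∨
  (((InI nI v ∧ InJ nI nJ w) ∨ (InJ nI nJ v ∧ InP nI nJ nO nP w) ∨
      (InI nI v ∧ InP nI nJ nO nP w)) ∧ (if v ≤ w then ω v w else ω w v) = true) ∨
  (InD nI nJ nO nP v ∧ InJ nI nJ w ∧ (w : ℕ) = nI + ((v : ℕ) - (nI + nJ + nO + nP)))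

/-- The (random) graph `G` determined by the family of independent random bits `ω`. -/
def blockGraph (nI nJ nO nP : ℕ) {n : ℕ} (ω : Fin n → Fin n → Bool) :
    SimpleGraph (Fin n) where
  Adj v w := v ≠ w ∧ (Rel nI nJ nO nP ω v w ∨ Rel nI nJ nO nP ω w v)
  symm := ⟨fun _ _ h => ⟨h.1.symm, h.2.symm⟩⟩
  loopless := ⟨fun _ h => h.1 rfl⟩

/-! ### Probability measures -/

/-- Bernoulli measure on `Bool` with success probability `p` (clamped to `[0,1]`). -/
noncomputable def bern (p : ℝ) : Measure Bool :=
  (PMF.bernoulli (min (Real.toNNReal p) 1) (min_le_right _ _)).toMeasure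

instance (p : ℝ) : IsProbabilityMeasure (bern p) := by
  unfold bern; infer_instance

/-- The success probability of the random bit attached to the (ordered) pair
`(v, w)`: `p_IJ = p_JP = (1/2−δ)/(1/2+δ) + ε₁` for pairs in `I×J` and `J×P`,
and `p_IP = (1/2−δ)/(1/2+δ) − ε₂` for pairs in `I×P` (all other bits are unused). -/
noncomputable def edgeProb (nI nJ nO nP : ℕ) (δ ε₁ ε₂ : ℝ) {n : ℕ} (v w : Fin n) : ℝ :=
  if InI nI v ∧ InJ nI nJ w then (1 / 2 - δ) / (1 / 2 + δ) + ε₁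
  else if InJ nI nJ v ∧ InP nI nJ nO nP w then (1 / 2 - δ) / (1 / 2 + δ) + ε₁
  else if InI nI v ∧ InP nI nJ nO nP w then (1 / 2 - δ) / (1 / 2 + δ) - ε₂
  else 0

/-- The distribution of the random bits defining the graph `G`: all bits are
independent, and the bit of a pair in `I×J`, `J×P`, `I×P` is Bernoulli with
parameter `p_IJ`, `p_JP`, `p_IP` respectively. -/
noncomputable def edgeMeasure (n nI nJ nO nP : ℕ) (δ ε₁ ε₂ : ℝ) :
    Measure (Fin n → Fin n → Bool) :=
  Measure.pi fun v => Measure.pi fun w => bern (edgeProb nI nJ nO nP δ ε₁ ε₂ v w)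

/-- Independent fair coins, one for each vertex (used for random tie-breaking in
the non-iterative dissemination). -/
noncomputable def coinMeasure (n : ℕ) : Measure (Fin n → Bool) :=
  Measure.pi fun _ => bern (1 / 2)

/-- Independent fair coins, one for each round and each vertex (used for random
tie-breaking in the iterative dissemination). -/
noncomputable def tieMeasure (n : ℕ) : Measure (Fin n → Fin n → Bool) :=
  Measure.pi fun _ => Measure.pi fun _ => bern (1 / 2)

/-! ### The dissemination processes -/

/-- `Δ(v) = |N(v) ∩ E₁| − |N(v) ∩ E₀|`. -/
noncomputable def Delta {n : ℕ} (H : SimpleGraph (Fin n)) (E₁ E₀ : Finset (Fin n))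
    (v : Fin n) : ℤ :=
  ((H.neighborSet v ∩ ↑E₁).ncard : ℤ) - ((H.neighborSet v ∩ ↑E₀).ncard : ℤ)

/-- The non-iterative dissemination: experts keep their label; every other
vertex takes the majority label among its expert neighbours, ties (in
particular, vertices with no expert neighbour) being broken by the coin `c`. -/
noncomputable def labelNonIter {n : ℕ} (H : SimpleGraph (Fin n)) (E₁ E₀ : Finset (Fin n))
    (c : Fin n → Bool) (v : Fin n) : Bool :=
  if v ∈ E₁ then true
  else if v ∈ E₀ then false
  else if 0 < Delta H E₁ E₀ v then true
  else if Delta H E₁ E₀ v < 0 then false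
  else c v

/-- One round of the iterative dissemination: an unlabeled vertex gets label
`1` (resp. `0`) if it has strictly more (resp. fewer) `1`-labeled than
`0`-labeled neighbours; a tie involving at least one labeled neighbour is
broken by the coin; a vertex with no labeled neighbour stays unlabeled. -/
noncomputable def iterStep {n : ℕ} (H : SimpleGraph (Fin n)) (coin : Fin n → Bool)
    (prev : Fin n → Option Bool) (v : Fin n) : Option Bool :=
  match prev v with
  | some b => some b
  | none =>
    let a := (H.neighborSet v ∩ {w | prev w = some true}).ncard
    let z := (H.neighborSet v ∩ {w | prev w = some false}).ncard
    if z < a then some true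
    else if a < z then some false
    else if a = 0 then none
    else some (coin v)

/-- The state of the iterative dissemination after `t` rounds, starting from
the expert labeling given by `E₁, E₀` and using the tie-breaking coins `tb`. -/
noncomputable def iterLabel {n : ℕ} (H : SimpleGraph (Fin n)) (E₁ E₀ : Finset (Fin n))
    (tb : ℕ → Fin n → Bool) : ℕ → Fin n → Option Bool
  | 0 => fun v => if v ∈ E₁ then some true else if v ∈ E₀ then some false else none
  | t + 1 => iterStep H (tb t) (iterLabel H E₁ E₀ tb t)

/-- Reading off per-round tie-breaking coins from a `Fin n`-indexed family.
Since in every round the set of labeled vertices only grows, the iterative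
process stabilizes after at most `n` rounds, so `n` rounds of coins suffice. -/
def tieOf {n : ℕ} (T : Fin n → Fin n → Bool) (t : ℕ) : Fin n → Bool :=
  if h : t < n then T ⟨t, h⟩ else fun _ => true

/-! ### Robustness -/

/-- `sI, sJ, sO, sP, sD` are admissible block sizes for `n` vertices: they have
the prescribed cardinalities (all of which are integers), and `|D| ≤ |J|` so
that the matching from `D` into `J` exists. -/
def AdmissibleSizes (μ δ d : ℝ) (sI sJ sO sP sD : ℕ → ℕ) (n : ℕ) : Prop :=
  sI n + sJ n + sO n + sP n + sD n = n ∧ sD n ≤ sJ n ∧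
  ((sI n : ℝ)) = μ * (1 / 2 + δ) * n ∧
  ((sO n : ℝ)) = μ * (1 / 2 - δ) * n ∧
  ((sI n : ℝ)) + ((sJ n : ℝ)) = (1 - d) * n / 2 ∧
  ((sO n : ℝ)) + ((sP n : ℝ)) = (1 - d) * n / 2 ∧
  ((sD n : ℝ)) = d * n

/-- The event (on the randomness of the graph together with the tie-breaking
coins) that for every admissible choice of the expert sets `E₁, E₀` by the
strong adversary, more than half of all vertices are labeled `1` at the end of
the iterative dissemination. -/
def IterMajority (μ δ : ℝ) (n nI nJ nO nP : ℕ)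
    (ω : (Fin n → Fin n → Bool) × (Fin n → Fin n → Bool)) : Prop :=
  ∀ E₁ E₀ : Finset (Fin n), Disjoint E₁ E₀ →
    ((E₁.card : ℝ)) = (1 / 2 + δ) * μ * n →
    ((E₀.card : ℝ)) = (1 / 2 - δ) * μ * n →
    n < 2 * ({v : Fin n |
      iterLabel (blockGraph nI nJ nO nP ω.1) E₁ E₀ (tieOf ω.2) n v = some true}.ncard)

/-- The event (on the randomness of the graph together with the tie-breaking
coins) that for every admissible choice of the expert sets `E₁, E₀` by the
strong adversary, more than half of all vertices are labeled `1` at the end of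
the non-iterative dissemination. -/
def NonIterMajority (μ δ : ℝ) (n nI nJ nO nP : ℕ)
    (ω : (Fin n → Fin n → Bool) × (Fin n → Bool)) : Prop :=
  ∀ E₁ E₀ : Finset (Fin n), Disjoint E₁ E₀ →
    ((E₁.card : ℝ)) = (1 / 2 + δ) * μ * n →
    ((E₀.card : ℝ)) = (1 / 2 - δ) * μ * n →
    n < 2 * ({v : Fin n |
      labelNonIter (blockGraph nI nJ nO nP ω.1) E₁ E₀ ω.2 v = true}.ncard)

/-- The graph sequence `G = G_n` (with block sizes `sI, …, sD`) is robust
against the iterative strong adversary: with probability tending to `1` as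
`n → ∞` (along the admissible `n`), for every choice of the expert sets, more
than half of all vertices are labeled `1` after the iterative dissemination. -/
def RobustIter (μ δ ε₁ ε₂ d : ℝ) (sI sJ sO sP sD : ℕ → ℕ) : Prop :=
  Tendsto
    (fun n : ℕ =>
      ((edgeMeasure n (sI n) (sJ n) (sO n) (sP n) δ ε₁ ε₂).prod (tieMeasure n))
        {ω | IterMajority μ δ n (sI n) (sJ n) (sO n) (sP n) ω})
    (atTop ⊓ 𝓟 {n | AdmissibleSizes μ δ d sI sJ sO sP sD n}) (nhds 1)

/-- The graph sequence `G = G_n` (with block sizes `sI, …, sD`) is robust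
against the non-iterative strong adversary: with probability tending to `1` as
`n → ∞` (along the admissible `n`), for every choice of the expert sets, more
than half of all vertices are labeled `1` after the non-iterative dissemination. -/
def RobustNonIter (μ δ ε₁ ε₂ d : ℝ) (sI sJ sO sP sD : ℕ → ℕ) : Prop :=
  Tendsto
    (fun n : ℕ =>
      ((edgeMeasure n (sI n) (sJ n) (sO n) (sP n) δ ε₁ ε₂).prod (coinMeasure n))
        {ω | NonIterMajority μ δ n (sI n) (sJ n) (sO n) (sP n) ω})
    (atTop ⊓ 𝓟 {n | AdmissibleSizes μ δ d sI sJ sO sP sD n}) (nhds 1)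

open ProbabilityTheory

/-! ### Concentration of weighted sums of the random bits -/

lemma bern_apply_true {p : ℝ} (h0 : 0 ≤ p) (h1 : p ≤ 1) : (bern p).real {true} = p := by
  have h : Real.toNNReal p ≤ 1 := by simpa using h1
  simp [bern, Measure.real, PMF.bernoulli_apply, h, h0]

lemma integral_bern_indicator {p : ℝ} (h0 : 0 ≤ p) (h1 : p ≤ 1) :
    ∫ b, (if b = true then (1 : ℝ) else 0) ∂(bern p) = p := by
  have h : (fun b : Bool => if b = true then (1 : ℝ) else 0)
      = Set.indicator {true} (fun _ => (1 : ℝ)) := by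
    ext b; simp [Set.indicator]
  rw [h, integral_indicator_const _ (by measurability), bern_apply_true h0 h1]
  simp

lemma hasSubgaussianMGF_bern {p : ℝ} (h0 : 0 ≤ p) (h1 : p ≤ 1) (s : ℝ) :
    HasSubgaussianMGF (fun b : Bool => s * ((if b = true then (1 : ℝ) else 0) - p))
      (Real.toNNReal (s ^ 2 / 4)) (bern p) := by
  have h := hasSubgaussianMGF_of_mem_Icc (μ := bern p) (a := 0) (b := 1)
    (X := fun b : Bool => if b = true then (1 : ℝ) else 0)
    (measurable_of_countable _).aemeasurable
    (ae_of_all _ fun b => by cases b <;> simp)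
  rw [integral_bern_indicator h0 h1] at h
  convert! h.const_mul s using 1
  ext
  rw [Real.coe_toNNReal _ (by positivity)]
  change s ^ 2 / 4 = s ^ 2 * (((‖(1 : ℝ) - 0‖₊ / 2) ^ 2 : NNReal) : ℝ)
  norm_num
  ring

lemma hasSubgaussianMGF_pi_sum {ι : Type*} [Fintype ι] {Ω : ι → Type*}
    [∀ i, MeasurableSpace (Ω i)] (μ : ∀ i, Measure (Ω i)) [∀ i, IsProbabilityMeasure (μ i)]
    {X : ∀ i, Ω i → ℝ} {c : ι → NNReal} (h : ∀ i, HasSubgaussianMGF (X i) (c i) (μ i)) :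
    HasSubgaussianMGF (fun ω : ∀ i, Ω i => ∑ i, X i (ω i)) (∑ i, c i) (Measure.pi μ) := by
  refine HasSubgaussianMGF.sum_of_iIndepFun (X := fun i (ω : ∀ i, Ω i) => X i (ω i))
    (iIndepFun_pi fun i => (h i).aemeasurable) fun i _ => ?_
  have hp := measurePreserving_eval μ i
  exact HasSubgaussianMGF.of_map (Y := Function.eval i) hp.measurable.aemeasurable
    (by rw [hp.map_eq]; exact h i)

/-- Hoeffding's inequality for weighted sums of independent Bernoulli bits. -/
lemma measure_weighted_sum_ge_le {n : ℕ} (p : Fin n → Fin n → ℝ) (hp0 : ∀ v w, 0 ≤ p v w)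
    (hp1 : ∀ v w, p v w ≤ 1) (s : Fin n → Fin n → ℝ) {t V : ℝ} (ht : 0 ≤ t)
    (hV0 : 0 < V) (hV : ∑ v, ∑ w, s v w ^ 2 ≤ V) :
    (Measure.pi fun v => Measure.pi fun w => bern (p v w)).real
      {ω | t ≤ ∑ v, ∑ w, s v w * ((if ω v w = true then (1 : ℝ) else 0) - p v w)}
      ≤ Real.exp (-(2 * t ^ 2 / V)) := by
  have h := hasSubgaussianMGF_pi_sum (fun v => Measure.pi fun w => bern (p v w))
    (fun v => hasSubgaussianMGF_pi_sum (fun w => bern (p v w))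
      fun w => hasSubgaussianMGF_bern (hp0 v w) (hp1 v w) (s v w))
  set C : NNReal := ∑ v, ∑ w, Real.toNNReal (s v w ^ 2 / 4) with hC
  have hCV : (C : ℝ) ≤ V / 4 := by
    have : (C : ℝ) = (∑ v, ∑ w, s v w ^ 2) / 4 := by
      rw [hC]; push_cast
      simp_rw [Finset.sum_div]
      exact Finset.sum_congr rfl fun v _ => Finset.sum_congr rfl fun w _ =>
        Real.coe_toNNReal _ (by positivity)
    rw [this]; linarith
  have h' : HasSubgaussianMGF (fun ω : Fin n → Fin n → Bool =>
      ∑ v, ∑ w, s v w * ((if ω v w = true then (1 : ℝ) else 0) - p v w))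
      (Real.toNNReal (V / 4)) (Measure.pi fun v => Measure.pi fun w => bern (p v w)) := by
    refine ⟨h.integrable_exp_mul, fun u => (h.mgf_le u).trans ?_⟩
    rw [Real.coe_toNNReal _ (by positivity)]
    gcongr
  refine (h'.measure_ge_le ht).trans_eq ?_
  rw [Real.coe_toNNReal _ (by positivity)]
  congr 1
  field_simp
  ring

/-- A majority of heads among the coins indexed by `A` has probability at most one half. -/
lemma coinMeasure_majority_le {n : ℕ} (A : Finset (Fin n)) :
    coinMeasure n {c | A.card < 2 * (A.filter fun v => c v = true).card} ≤ 1 / 2 := by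
  have hflip : MeasurePreserving (fun b : Bool => !b) (bern (1 / 2)) (bern (1 / 2)) := by
    refine ⟨measurable_of_countable _, ?_⟩
    refine Measure.ext_of_singleton fun b => ?_
    rw [Measure.map_apply (measurable_of_countable _) (measurableSet_singleton _)]
    have h1 : (bern (1 / 2)).real {true} = 1 / 2 := bern_apply_true (by norm_num) (by norm_num)
    have h2 : (bern (1 / 2)).real {false} = 1 / 2 := by
      have : ({false} : Set Bool) = {true}ᶜ := by ext x; cases x <;> simp
      rw [this, probReal_compl_eq_one_sub (measurableSet_singleton _), h1]
      norm_num
    have h4 : bern (1 / 2) {false} = bern (1 / 2) {true} := by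
      rw [← measureReal_eq_measureReal_iff, h1, h2]
    have h5 : (fun b : Bool => !b) ⁻¹' {b} = {!b} := by ext x; cases x <;> cases b <;> simp
    rw [h5]
    cases b <;> simp only [Bool.not_true, Bool.not_false, h4]
  have hpi : MeasurePreserving (fun (c : Fin n → Bool) v => !(c v))
      (coinMeasure n) (coinMeasure n) := measurePreserving_pi _ _ fun _ => hflip
  set H : Set (Fin n → Bool) := {c | A.card < 2 * (A.filter fun v => c v = true).card}
  have hm : MeasurableSet H := Set.Finite.measurableSet (Set.toFinite _)
  have hdisj : Disjoint H ((fun (c : Fin n → Bool) v => !(c v)) ⁻¹' H) := by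
    rw [Set.disjoint_left]
    intro c h1 h2
    simp only [H, Set.mem_ofPred_eq, Set.mem_preimage, Bool.not_eq_true'] at h1 h2
    have := Finset.card_filter_add_card_filter_not (s := A) (fun v => c v = true)
    simp only [Bool.not_eq_true] at this
    omega
  have : IsProbabilityMeasure (coinMeasure n) := by unfold coinMeasure; infer_instance
  have h1 : coinMeasure n H + coinMeasure n H ≤ 1 := by
    nth_rewrite 2 [← hpi.measure_preimage hm.nullMeasurableSet]
    rw [← measure_union hdisj (hpi.measurable hm)]
    exact prob_le_one
  rw [ENNReal.le_div_iff_mul_le (by simp) (by simp), mul_two]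
  exact h1

/-! ### Adjacency as a perturbation of its mean -/

/-- The pair `(v, w)` is joined by a random edge recorded in the bit of `(v, w)`. -/
abbrev Fwd (nI nJ nO nP : ℕ) {n : ℕ} (v w : Fin n) : Prop :=
  (InI nI v ∧ InJ nI nJ w) ∨ (InJ nI nJ v ∧ InP nI nJ nO nP w) ∨
    (InI nI v ∧ InP nI nJ nO nP w)

/-- The adjacency kernel outside `D`, with `q` in place of the random bits. -/
noncomputable def kernel (nI nJ nO nP : ℕ) {n : ℕ} (q : Fin n → Fin n → ℝ) (v w : Fin n) : ℝ :=
  if Fwd nI nJ nO nP v w then q v w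
  else if Fwd nI nJ nO nP w v then q w v
  else if InD nI nJ nO nP v ∨ InD nI nJ nO nP w then 0
  else 1

/-- The random bits as real numbers. -/
noncomputable def bitVal {n : ℕ} (ω : Fin n → Fin n → Bool) (v w : Fin n) : ℝ :=
  if ω v w = true then 1 else 0

/-- The surplus of `E₁` over `E₀` seen from `v` through the kernel. -/
noncomputable def kernelDelta (nI nJ nO nP : ℕ) {n : ℕ} (q : Fin n → Fin n → ℝ)
    (E₁ E₀ : Finset (Fin n)) (v : Fin n) : ℝ :=
  ∑ w ∈ E₁, kernel nI nJ nO nP q v w - ∑ w ∈ E₀, kernel nI nJ nO nP q v w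

section Deterministic

variable {nI nJ nO nP n : ℕ}

lemma rel_iff_of_fwd (ω : Fin n → Fin n → Bool) {v w : Fin n} (h : Fwd nI nJ nO nP v w) :
    Rel nI nJ nO nP ω v w ↔ ω v w = true := by
  have hle : v ≤ w := by rw [Fin.le_def]; omega
  unfold Rel
  rw [if_pos hle]
  constructor
  · rintro (h' | h' | h' | h' | h' | h')
    on_goal 5 => exact h'.2
    all_goals exfalso; omega
  · exact fun h' => .inr (.inr (.inr (.inr (.inl ⟨h, h'⟩))))

lemma not_rel_of_fwd (ω : Fin n → Fin n → Bool) {v w : Fin n} (h : Fwd nI nJ nO nP v w) :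
    ¬ Rel nI nJ nO nP ω w v := by
  rintro (h' | h' | h' | h' | ⟨h', -⟩ | h') <;> omega

lemma rel_or_rel_of_not_fwd (ω : Fin n → Fin n → Bool) {v w : Fin n}
    (hv : ¬ InD nI nJ nO nP v) (hw : ¬ InD nI nJ nO nP w)
    (h : ¬ Fwd nI nJ nO nP v w) (h' : ¬ Fwd nI nJ nO nP w v) :
    Rel nI nJ nO nP ω v w ∨ Rel nI nJ nO nP ω w v := by
  have : (InI nI v ∧ InI nI w) ∨ (InJ nI nJ v ∧ InJ nI nJ w) ∨
      (InP nI nJ nO nP v ∧ InP nI nJ nO nP w) ∨ InO nI nJ nO v ∨ InO nI nJ nO w := by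
    omega
  rcases this with h | h | h | h | h
  · exact .inl (.inl h)
  · exact .inl (.inr (.inl h))
  · exact .inl (.inr (.inr (.inl h)))
  · exact .inl (.inr (.inr (.inr (.inl ⟨h, hw⟩))))
  · exact .inr (.inr (.inr (.inr (.inl ⟨h, hv⟩))))

lemma kernel_eq_adj (ω : Fin n → Fin n → Bool) {v w : Fin n} (hvw : v ≠ w)
    (hv : ¬ InD nI nJ nO nP v) (hw : ¬ InD nI nJ nO nP w)
    [Decidable ((blockGraph nI nJ nO nP ω).Adj v w)] :
    (if (blockGraph nI nJ nO nP ω).Adj v w then (1 : ℝ) else 0)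
      = kernel nI nJ nO nP (bitVal ω) v w := by
  have hadj : (blockGraph nI nJ nO nP ω).Adj v w ↔
      Rel nI nJ nO nP ω v w ∨ Rel nI nJ nO nP ω w v := by simp [blockGraph, hvw]
  unfold kernel bitVal
  by_cases h1 : Fwd nI nJ nO nP v w
  · simp only [hadj, rel_iff_of_fwd ω h1, not_rel_of_fwd ω h1, or_false, if_pos h1]
  by_cases h2 : Fwd nI nJ nO nP w v
  · simp only [hadj, rel_iff_of_fwd ω h2, not_rel_of_fwd ω h2, false_or, if_neg h1, if_pos h2]
  · rw [if_pos (hadj.2 (rel_or_rel_of_not_fwd ω hv hw h1 h2)), if_neg h1, if_neg h2,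
      if_neg (by tauto)]

lemma ncard_neighborSet_inter (H : SimpleGraph (Fin n)) (E : Finset (Fin n)) (v : Fin n)
    [DecidableRel H.Adj] :
    (((H.neighborSet v ∩ ↑E).ncard : ℤ) : ℝ) = ∑ w ∈ E, if H.Adj v w then (1 : ℝ) else 0 := by
  have h : H.neighborSet v ∩ ↑E = ↑(E.filter fun w => H.Adj v w) := by
    ext w; simp [and_comm]
  rw [h, Set.ncard_coe_finset]
  simp

lemma kernelDelta_sub_one_le_Delta (ω : Fin n → Fin n → Bool) {E₁ E₀ : Finset (Fin n)}
    {v : Fin n} (hv : ¬ InD nI nJ nO nP v) (h1 : v ∉ E₁) (h0 : v ∉ E₀) :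
    kernelDelta nI nJ nO nP (bitVal ω) E₁ E₀ v - 1
      ≤ (Delta (blockGraph nI nJ nO nP ω) E₁ E₀ v : ℝ) := by
  classical
  set H := blockGraph nI nJ nO nP ω with hH
  have hD : ∀ w, InD nI nJ nO nP w → kernel nI nJ nO nP (bitVal ω) v w = 0 := by
    intro w hw
    unfold kernel
    rw [if_neg, if_neg, if_pos (Or.inr hw)] <;> grind
  have hE1 : ∑ w ∈ E₁, kernel nI nJ nO nP (bitVal ω) v w
      ≤ ∑ w ∈ E₁, if H.Adj v w then (1 : ℝ) else 0 := by
    refine Finset.sum_le_sum fun w hw => ?_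
    by_cases hwD : InD nI nJ nO nP w
    · rw [hD w hwD]; split_ifs <;> norm_num
    · exact (kernel_eq_adj ω (by rintro rfl; exact h1 hw) hv hwD).ge
  have hone : (E₀.filter fun w => H.Adj v w ∧ InD nI nJ nO nP w).card ≤ 1 := by
    refine Finset.card_le_one.2 fun x hx y hy => Fin.ext ?_
    have key : ∀ w, H.Adj v w → InD nI nJ nO nP w →
        (v : ℕ) = nI + ((w : ℕ) - (nI + nJ + nO + nP)) := by
      intro w hw hwD
      simp only [hH, blockGraph, Rel, InI, InJ, InO, InP, InD] at hw hwD hv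
      omega
    obtain ⟨-, hx, hxD⟩ := Finset.mem_filter.1 hx
    obtain ⟨-, hy, hyD⟩ := Finset.mem_filter.1 hy
    have := key x hx hxD
    have := key y hy hyD
    omega
  have hE0 : (∑ w ∈ E₀, if H.Adj v w then (1 : ℝ) else 0)
      ≤ ∑ w ∈ E₀, kernel nI nJ nO nP (bitVal ω) v w + 1 := by
    calc (∑ w ∈ E₀, if H.Adj v w then (1 : ℝ) else 0)
        ≤ ∑ w ∈ E₀, (kernel nI nJ nO nP (bitVal ω) v w
            + if H.Adj v w ∧ InD nI nJ nO nP w then (1 : ℝ) else 0) := by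
          refine Finset.sum_le_sum fun w hw => ?_
          by_cases hwD : InD nI nJ nO nP w
          · simp [hD w hwD, hwD]
          · simp only [hwD, and_false, if_false, add_zero]
            exact (kernel_eq_adj ω (by rintro rfl; exact h0 hw) hv hwD).le
      _ ≤ _ := by
          rw [Finset.sum_add_distrib]
          gcongr
          simpa using mod_cast hone
  unfold Delta kernelDelta
  push_cast [ncard_neighborSet_inter]
  have e1 := ncard_neighborSet_inter H E₁ v
  have e0 := ncard_neighborSet_inter H E₀ v
  push_cast at e1 e0
  rw [e1, e0]
  linarith

/-- The weight of the bit of `(v, w)` in the total surplus of `E₁` over `E₀` seen from `S`. -/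
noncomputable def noiseWeight (nI nJ nO nP : ℕ) (S E₁ E₀ : Finset (Fin n)) (v w : Fin n) : ℝ :=
  if Fwd nI nJ nO nP v w then
    (if v ∈ S then (if w ∈ E₁ then (1 : ℝ) else 0) - (if w ∈ E₀ then 1 else 0) else 0)
    + (if w ∈ S then (if v ∈ E₁ then (1 : ℝ) else 0) - (if v ∈ E₀ then 1 else 0) else 0)
  else 0

lemma noiseWeight_sq_le (S E₁ E₀ : Finset (Fin n)) (v w : Fin n) :
    noiseWeight nI nJ nO nP S E₁ E₀ v w ^ 2 ≤ 4 := by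
  unfold noiseWeight
  split_ifs <;> norm_num

lemma sum_kernelDelta_sub (q p : Fin n → Fin n → ℝ) (S E₁ E₀ : Finset (Fin n)) :
    ∑ v ∈ S, (kernelDelta nI nJ nO nP q E₁ E₀ v - kernelDelta nI nJ nO nP p E₁ E₀ v)
      = ∑ v, ∑ w, noiseWeight nI nJ nO nP S E₁ E₀ v w * (q v w - p v w) := by
  set f : Fin n → Fin n → ℝ := fun v w =>
    if Fwd nI nJ nO nP v w then q v w - p v w else 0 with hf
  set g : Fin n → Fin n → ℝ := fun v w =>
    if v ∈ S then (if w ∈ E₁ then (1 : ℝ) else 0) - (if w ∈ E₀ then 1 else 0) else 0 with hg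
  have hk : ∀ v w, kernel nI nJ nO nP q v w - kernel nI nJ nO nP p v w = f v w + f w v := by
    intro v w
    have : Fwd nI nJ nO nP v w → ¬ Fwd nI nJ nO nP w v := by grind
    by_cases h1 : Fwd nI nJ nO nP v w
    · simp only [kernel, hf, if_pos h1, if_neg (this h1)]; ring
    by_cases h2 : Fwd nI nJ nO nP w v
    · simp only [kernel, hf, if_neg h1, if_pos h2]; ring
    · simp only [kernel, hf, if_neg h1, if_neg h2]; ring
  have hL : ∀ v, (if v ∈ S then kernelDelta nI nJ nO nP q E₁ E₀ v
      - kernelDelta nI nJ nO nP p E₁ E₀ v else 0) = ∑ w, g v w * (f v w + f w v) := by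
    intro v
    by_cases hv : v ∈ S
    · have hE : ∀ (E : Finset (Fin n)) (F : Fin n → ℝ),
          ∑ w ∈ E, F w = ∑ w, (if w ∈ E then (1 : ℝ) else 0) * F w := by
        intro E F; simp [Finset.sum_ite_mem]
      have hsplit : kernelDelta nI nJ nO nP q E₁ E₀ v - kernelDelta nI nJ nO nP p E₁ E₀ v
          = ∑ w ∈ E₁, (f v w + f w v) - ∑ w ∈ E₀, (f v w + f w v) := by
        simp only [← hk, Finset.sum_sub_distrib, kernelDelta]; ring
      rw [if_pos hv, hsplit, hE E₁, hE E₀, ← Finset.sum_sub_distrib]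
      exact Finset.sum_congr rfl fun w _ => by simp only [hg, hv, if_true]; ring
    · simp [hv, hg]
  have hS : ∑ v ∈ S, (kernelDelta nI nJ nO nP q E₁ E₀ v - kernelDelta nI nJ nO nP p E₁ E₀ v)
      = ∑ v, ∑ w, g v w * (f v w + f w v) := by
    simp_rw [← hL]; simp [Finset.sum_ite_mem]
  rw [hS]
  simp_rw [mul_add, Finset.sum_add_distrib]
  rw [Finset.sum_comm (f := fun v w => g v w * f w v)]
  simp_rw [← Finset.sum_add_distrib]
  refine Finset.sum_congr rfl fun v _ => Finset.sum_congr rfl fun w _ => ?_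
  simp only [noiseWeight, hf, hg]
  by_cases h : Fwd nI nJ nO nP v w
  · simp only [h, if_true]; ring
  · simp only [h, if_false]; ring

/-- The random bits deviate little from their means `p`, as seen from every vertex set and
every choice of experts. -/
def LowNoise (nI nJ nO nP : ℕ) (p : Fin n → Fin n → ℝ) (η : ℝ)
    (ω : Fin n → Fin n → Bool) : Prop :=
  ∀ S E₁ E₀ : Finset (Fin n), -(η * (n : ℝ) ^ 2)
    < ∑ v, ∑ w, noiseWeight nI nJ nO nP S E₁ E₀ v w * (bitVal ω v w - p v w)

lemma card_mul_le_of_lowNoise {p : Fin n → Fin n → ℝ} {η θ : ℝ} {ω : Fin n → Fin n → Bool}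
    (hω : LowNoise nI nJ nO nP p η ω) {E₁ E₀ : Finset (Fin n)} {S : Finset (Fin n)}
    (hS : ∀ v ∈ S, ¬ InD nI nJ nO nP v ∧ v ∉ E₁ ∧ v ∉ E₀ ∧
      Delta (blockGraph nI nJ nO nP ω) E₁ E₀ v ≤ 0 ∧
      θ * n ≤ kernelDelta nI nJ nO nP p E₁ E₀ v) :
    S.card * (θ * n) ≤ n + η * (n : ℝ) ^ 2 := by
  have h := hω S E₁ E₀
  rw [← sum_kernelDelta_sub] at h
  have h2 : ∑ v ∈ S, (kernelDelta nI nJ nO nP (bitVal ω) E₁ E₀ v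
      - kernelDelta nI nJ nO nP p E₁ E₀ v) ≤ ∑ v ∈ S, (1 - θ * n) := by
    refine Finset.sum_le_sum fun v hv => ?_
    obtain ⟨hD, h1, h0, hd, hk⟩ := hS v hv
    have h3 := kernelDelta_sub_one_le_Delta ω hD h1 h0
    have h4 : (Delta (blockGraph nI nJ nO nP ω) E₁ E₀ v : ℝ) ≤ 0 := by exact_mod_cast hd
    linarith
  rw [Finset.sum_const, nsmul_eq_mul] at h2
  have h5 : (S.card : ℝ) ≤ n := by
    exact_mod_cast (Finset.card_le_univ S).trans_eq (Fintype.card_fin n)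
  nlinarith

/-! ### The iterative dissemination -/

lemma iterLabel_mono (H : SimpleGraph (Fin n)) (E₁ E₀ : Finset (Fin n)) (tb : ℕ → Fin n → Bool)
    {s t : ℕ} (hst : s ≤ t) {v : Fin n} {b : Bool} (h : iterLabel H E₁ E₀ tb s v = some b) :
    iterLabel H E₁ E₀ tb t v = some b := by
  induction t, hst using Nat.le_induction with
  | base => exact h
  | succ t _ ih => simp [iterLabel, iterStep, ih]

lemma iterLabel_one_of_Delta_pos (H : SimpleGraph (Fin n)) {E₁ E₀ : Finset (Fin n)}
    (hE : Disjoint E₁ E₀) (tb : ℕ → Fin n → Bool) {v : Fin n} (h0 : v ∉ E₀)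
    (h : v ∈ E₁ ∨ 0 < Delta H E₁ E₀ v) : iterLabel H E₁ E₀ tb 1 v = some true := by
  by_cases h1 : v ∈ E₁
  · exact iterLabel_mono H E₁ E₀ tb (Nat.zero_le 1) (by simp [iterLabel, h1])
  have hd := h.resolve_left h1
  have ht : {w | iterLabel H E₁ E₀ tb 0 w = some true} = ↑E₁ := by
    ext w; simp only [iterLabel]; by_cases hw : w ∈ E₁ <;> simp [hw]
  have hf : {w | iterLabel H E₁ E₀ tb 0 w = some false} = ↑E₀ := by
    ext w
    have := fun h : w ∈ E₁ => Finset.disjoint_left.1 hE h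
    by_cases hw : w ∈ E₁ <;> by_cases hw0 : w ∈ E₀ <;> simp_all [iterLabel]
  have hv : iterLabel H E₁ E₀ tb 0 v = none := by simp [iterLabel, h0, h1]
  simp only [Delta] at hd
  rw [iterLabel, iterStep, hv]
  simp only [ht, hf]
  rw [if_pos (by omega)]

lemma iterLabel_two_of_pendant (H : SimpleGraph (Fin n)) {E₁ E₀ : Finset (Fin n)}
    (tb : ℕ → Fin n → Bool) {v u : Fin n} (h1 : v ∉ E₁) (h0 : v ∉ E₀)
    (hN : H.neighborSet v = {u}) (hu : iterLabel H E₁ E₀ tb 1 u = some true) :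
    iterLabel H E₁ E₀ tb 2 v = some true := by
  have key : ∀ t, iterLabel H E₁ E₀ tb t v = none → iterLabel H E₁ E₀ tb t u = some true →
      iterLabel H E₁ E₀ tb (t + 1) v = some true := by
    intro t hv hu
    have e1 : ({u} ∩ {w | iterLabel H E₁ E₀ tb t w = some true} : Set (Fin n)) = {u} := by
      ext w; simp; rintro rfl; exact hu
    have e0 : ({u} ∩ {w | iterLabel H E₁ E₀ tb t w = some false} : Set (Fin n)) = ∅ := by
      ext w; simp; rintro rfl; simp [hu]
    rw [iterLabel, iterStep, hv]
    simp [hN, e1, e0]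
  have hv : iterLabel H E₁ E₀ tb 0 v = none := by simp [iterLabel, h0, h1]
  cases hu0 : iterLabel H E₁ E₀ tb 0 u with
  | some b =>
    have := iterLabel_mono H E₁ E₀ tb (Nat.zero_le 1) hu0
    rw [hu] at this
    obtain rfl : true = b := by simpa using this
    exact iterLabel_mono H E₁ E₀ tb one_le_two (key 0 hv hu0)
  | none =>
    refine key 1 ?_ hu
    have e : ∀ b, ({u} ∩ {w | iterLabel H E₁ E₀ tb 0 w = some b} : Set (Fin n)) = ∅ := by
      intro b; ext w; simp; rintro rfl; simp [hu0]
    rw [iterLabel, iterStep, hv]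
    simp [hN, e]

/-! ### Surplus of the experts in the mean -/

lemma mul_card_sub_le_sum {k : Fin n → ℝ} {c : ℝ} {A : Fin n → Prop} [DecidablePred A]
    (hk : ∀ w, 0 ≤ k w) (hc : ∀ w, ¬ A w → c ≤ k w) (E : Finset (Fin n)) :
    c * (E.card - (E.filter A).card) ≤ ∑ w ∈ E, k w := by
  have h := Finset.card_filter_add_card_filter_not (s := E) A
  have h' : (E.card : ℝ) - (E.filter A).card = (E.filter fun w => ¬ A w).card := by
    rw [← h]; push_cast; ring
  rw [h', ← Finset.sum_filter_add_sum_filter_not E A]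
  have h1 : 0 ≤ ∑ w ∈ E.filter A, k w := Finset.sum_nonneg fun w _ => hk w
  have h2 := Finset.card_nsmul_le_sum (E.filter fun w => ¬ A w) k c
    fun w hw => hc w (Finset.mem_filter.1 hw).2
  rw [nsmul_eq_mul] at h2
  linarith

lemma sum_le_card_sub {k : Fin n → ℝ} {A : Fin n → Prop} [DecidablePred A]
    (hk : ∀ w, k w ≤ 1) (hA : ∀ w, A w → k w ≤ 1 / 2) (E : Finset (Fin n)) :
    ∑ w ∈ E, k w ≤ E.card - (E.filter A).card / 2 := by
  have h := Finset.card_filter_add_card_filter_not (s := E) A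
  rw [← Finset.sum_filter_add_sum_filter_not E A, ← h]
  have h1 := Finset.sum_le_card_nsmul (E.filter A) k (1 / 2)
    fun w hw => hA w (Finset.mem_filter.1 hw).2
  have h2 := Finset.sum_le_card_nsmul (E.filter fun w => ¬ A w) k 1 fun w _ => hk w
  rw [nsmul_eq_mul] at h1 h2
  push_cast
  linarith

variable {δ ε₁ ε₂ ρ : ℝ}

/-- The possible values of the mean adjacency when the denser random pairs have probability
one half and the sparser ones have probability `ρ`. -/
lemma kernel_edgeProb (h1 : (1 / 2 - δ) / (1 / 2 + δ) + ε₁ = 1 / 2)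
    (h2 : (1 / 2 - δ) / (1 / 2 + δ) - ε₂ = ρ) (v w : Fin n) :
    kernel nI nJ nO nP (edgeProb nI nJ nO nP δ ε₁ ε₂) v w =
      if InD nI nJ nO nP v ∨ InD nI nJ nO nP w then 0
      else if (InI nI v ∧ InP nI nJ nO nP w) ∨ (InP nI nJ nO nP v ∧ InI nI w) then ρ
      else if (InJ nI nJ v ∧ ¬ InJ nI nJ w ∧ ¬ InO nI nJ nO w) ∨
        (InJ nI nJ w ∧ ¬ InJ nI nJ v ∧ ¬ InO nI nJ nO v) then 1 / 2
      else 1 := by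
  simp only [kernel, edgeProb, h1, h2]
  split_ifs <;> first | rfl | (exfalso; omega)

/-- The block sizes, in terms of their densities. -/
structure Sizes (nI nJ nO nP n : ℕ) (a b d : ℝ) : Prop where
  le_n : nI + nJ + nO + nP ≤ n
  D_le_J : n ≤ nI + nJ + nO + nP + nJ
  I_eq : (nI : ℝ) = a * n
  P_eq : (nP : ℝ) + b * n = (1 - d) * n / 2
  D_eq : (n : ℝ) = nI + nJ + nO + nP + d * n

lemma card_block {A : Fin n → Prop} [DecidablePred A] {x y : ℕ} (hy : y ≤ n)
    (h : ∀ v : Fin n, A v ↔ x ≤ (v : ℕ) ∧ (v : ℕ) < y) :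
    (Finset.univ.filter A).card = y - x := by
  rw [← Nat.card_Ico, ← Finset.card_map Fin.valEmbedding]
  congr 1
  ext m
  simp only [Finset.mem_map, Finset.mem_filter, Finset.mem_univ, true_and, h,
    Fin.valEmbedding_apply, Finset.mem_Ico]
  exact ⟨by rintro ⟨v, hv, rfl⟩; exact hv, fun hm => ⟨⟨m, by omega⟩, hm, rfl⟩⟩

lemma exists_pendant_neighbour {a b d : ℝ} (hs : Sizes nI nJ nO nP n a b d)
    (ω : Fin n → Fin n → Bool) {v : Fin n} (hv : InD nI nJ nO nP v) :
    ∃ u : Fin n, InJ nI nJ u ∧ (u : ℕ) = nI + ((v : ℕ) - (nI + nJ + nO + nP)) ∧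
      (blockGraph nI nJ nO nP ω).neighborSet v = {u} := by
  have h1 := hs.le_n
  have h2 := hs.D_le_J
  have h3 := v.isLt
  have hu : nI + ((v : ℕ) - (nI + nJ + nO + nP)) < n := by omega
  refine ⟨⟨_, hu⟩, ⟨by simp, by simp; omega⟩, rfl, ?_⟩
  ext w
  simp only [SimpleGraph.mem_neighborSet, Set.mem_singleton_iff]
  constructor
  · rintro ⟨-, (h | h | h | h | ⟨h, -⟩ | h) | (h | h | h | h | ⟨h, -⟩ | h)⟩
    on_goal 6 => exact Fin.ext h.2.2
    all_goals exfalso; omega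
  · rintro rfl
    refine ⟨fun h => ?_,
      .inl (.inr (.inr (.inr (.inr (.inr ⟨hv, ⟨by simp, by simp; omega⟩, rfl⟩)))))⟩
    have := congrArg Fin.val h
    simp only at this
    omega

lemma card_le_of_subset_union {W A B C E F : Finset (Fin n)}
    (h : W ⊆ A ∪ (B ∪ (C ∪ (E ∪ F)))) :
    (W.card : ℝ) ≤ A.card + (B.card + (C.card + (E.card + F.card))) := by
  have h1 := Finset.card_le_card h
  have h2 := Finset.card_union_le A (B ∪ (C ∪ (E ∪ F)))
  have h3 := Finset.card_union_le B (C ∪ (E ∪ F))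
  have h4 := Finset.card_union_le C (E ∪ F)
  have h5 := Finset.card_union_le E F
  exact_mod_cast (by omega : W.card ≤ A.card + (B.card + (C.card + (E.card + F.card))))

/-- If the bits deviate little from their means, then no choice of experts defeats the
iterative dissemination. -/
lemma iterMajority_of_lowNoise {a b d θ τ η : ℝ} (hs : Sizes nI nJ nO nP n a b d)
    (h1 : (1 / 2 - δ) / (1 / 2 + δ) + ε₁ = 1 / 2)
    (h2 : (1 / 2 - δ) / (1 / 2 + δ) - ε₂ = ρ) (hρ0 : 0 ≤ ρ) (hρ1 : ρ ≤ 1 / 2)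
    (hn : 2 ≤ n) (hθ : 0 < θ) (hJO : 2 * θ ≤ a - d - 2 * b)
    (hsmall : a + b + d + 3 * τ < 1 / 2) (hτ : 0 < τ)
    (hD : 2 * (θ + b - ρ * a) + ρ * (d + 8 * τ) ≤ d / 2 - 4 * τ)
    (hη : 1 + η * n ≤ θ * τ * n)
    {ω : Fin n → Fin n → Bool}
    (hω : LowNoise nI nJ nO nP (edgeProb nI nJ nO nP δ ε₁ ε₂) η ω)
    {E₁ E₀ : Finset (Fin n)} (hE : Disjoint E₁ E₀) (hE₁ : (E₁.card : ℝ) = a * n)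
    (hE₀ : (E₀.card : ℝ) = b * n) (tb : ℕ → Fin n → Bool) :
    n < 2 * ({v : Fin n |
      iterLabel (blockGraph nI nJ nO nP ω) E₁ E₀ tb n v = some true}.ncard) := by
  classical
  set H := blockGraph nI nJ nO nP ω with hH
  set k := kernel nI nJ nO nP (edgeProb (n := n) nI nJ nO nP δ ε₁ ε₂) with hk
  have hkval := kernel_edgeProb (n := n) (nI := nI) (nJ := nJ) (nO := nO) (nP := nP) h1 h2
  have hN : (0 : ℝ) < n := by exact_mod_cast (by omega : 0 < n)
  have hk0 : ∀ v w, 0 ≤ k v w := by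
    intro v w; rw [hk, hkval]; split_ifs <;> linarith
  have hk1 : ∀ v w, k v w ≤ 1 := by
    intro v w; rw [hk, hkval]; split_ifs <;> linarith
  set d₁ : ℕ := (E₁.filter fun w => InD nI nJ nO nP w).card with hd₁
  set j₀ : ℕ := (E₀.filter fun w => InJ nI nJ w).card with hj₀
  set Dblock : Finset (Fin n) := Finset.univ.filter fun w => InD nI nJ nO nP w with hDb
  have hDcard : (Dblock.card : ℝ) = d * n := by
    rw [hDb, card_block (x := nI + nJ + nO + nP) le_rfl (fun v => by simp [InD]),
      Nat.cast_sub hs.le_n]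
    push_cast
    linarith [hs.D_eq]
  have hd₁D : (d₁ : ℝ) ≤ d * n := by
    rw [← hDcard]
    exact_mod_cast Finset.card_le_card fun w hw => by
      simp only [hDb, Finset.mem_filter, Finset.mem_univ, true_and] at hw ⊢
      exact hw.2
  -- Vertices of `J ∪ O` see a surplus.
  have hsJO : ∀ v, InJ nI nJ v ∨ InO nI nJ nO v →
      θ * n ≤ kernelDelta nI nJ nO nP (edgeProb nI nJ nO nP δ ε₁ ε₂) E₁ E₀ v := by
    intro v hv
    have e1 := mul_card_sub_le_sum (c := 1 / 2) (A := fun w => InD nI nJ nO nP w) (hk0 v)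
      (fun w hw => by
        rw [hk, hkval]
        rw [if_neg (by omega), if_neg (by omega)]
        split_ifs <;> norm_num) E₁
    have e0 := sum_le_card_sub (A := fun _ => False) (hk1 v) (by simp) E₀
    simp only [Finset.filter_false, Finset.card_empty, Nat.cast_zero] at e0
    unfold kernelDelta
    rw [← hk]
    nlinarith
  -- Vertices of `I` and `P` see a joint surplus.
  have hsIP : ∀ v v', InI nI v → InP nI nJ nO nP v' →
      2 * (θ * n) ≤ kernelDelta nI nJ nO nP (edgeProb nI nJ nO nP δ ε₁ ε₂) E₁ E₀ v
        + kernelDelta nI nJ nO nP (edgeProb nI nJ nO nP δ ε₁ ε₂) E₁ E₀ v' := by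
    intro v v' hv hv'
    have e1 := mul_card_sub_le_sum (k := fun w => k v w + k v' w) (c := 1)
      (A := fun w => InD nI nJ nO nP w)
      (fun w => add_nonneg (hk0 v w) (hk0 v' w))
      (fun w hw => by
        have hO : InO nI nJ nO w ∨ InI nI w ∨ InJ nI nJ w ∨ InP nI nJ nO nP w := by omega
        simp only [hk, hkval]
        split_ifs <;> first | linarith | (exfalso; omega)) E₁
    have e0 := sum_le_card_sub (A := fun _ => False) (hk1 v) (by simp) E₀
    have e0' := sum_le_card_sub (A := fun _ => False) (hk1 v') (by simp) E₀
    simp only [Finset.filter_false, Finset.card_empty, Nat.cast_zero] at e0 e0'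
    rw [Finset.sum_add_distrib] at e1
    unfold kernelDelta
    rw [← hk]
    nlinarith
  -- The misled vertices of a class that sees a surplus are few.
  set bad : (Fin n → Prop) → Finset (Fin n) := fun B =>
    Finset.univ.filter fun v => B v ∧ v ∉ E₁ ∧ v ∉ E₀ ∧ Delta H E₁ E₀ v ≤ 0 with hbad
  have hbadcard : ∀ B : Fin n → Prop, (∀ v, B v → ¬ InD nI nJ nO nP v) →
      (∀ v, B v → θ * n ≤ kernelDelta nI nJ nO nP (edgeProb nI nJ nO nP δ ε₁ ε₂) E₁ E₀ v) →
      ((bad B).card : ℝ) ≤ τ * n := by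
    intro B hB hB'
    have h := card_mul_le_of_lowNoise (θ := θ) hω (E₁ := E₁) (E₀ := E₀) (S := bad B)
      (fun v hv => by
        obtain ⟨hv, h1, h0, hd⟩ := (Finset.mem_filter.1 hv).2
        exact ⟨hB v hv, h1, h0, hd, hB' v hv⟩)
    have h' : ((bad B).card : ℝ) * (θ * n) ≤ τ * n * (θ * n) := by nlinarith
    exact le_of_mul_le_mul_right h' (by positivity)
  have hgood : ∀ (B : Fin n → Prop) (v : Fin n), B v → v ∉ E₀ → v ∉ bad B →
      iterLabel H E₁ E₀ tb 1 v = some true := by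
    intro B v hv h0 hb
    refine iterLabel_one_of_Delta_pos H hE tb h0 ?_
    by_contra! hcon
    exact hb (Finset.mem_filter.2 ⟨Finset.mem_univ _, hv, hcon.1, h0, hcon.2⟩)
  have hend : ∀ v, iterLabel H E₁ E₀ tb 1 v = some true →
      iterLabel H E₁ E₀ tb n v = some true :=
    fun v hv => iterLabel_mono H E₁ E₀ tb (by omega) hv
  set JO : Fin n → Prop := fun v => InJ nI nJ v ∨ InO nI nJ nO v with hJOdef
  have hbJO := hbadcard JO (fun v hv => by simp only [hJOdef] at hv; omega) hsJO
  -- It suffices to bound the number of vertices not labeled `1`.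
  set Wc : Finset (Fin n) :=
    Finset.univ.filter fun v => ¬ iterLabel H E₁ E₀ tb n v = some true with hWc
  suffices hgoal : 2 * (Wc.card : ℝ) < n by
    have e : {v : Fin n | iterLabel H E₁ E₀ tb n v = some true}
        = ↑(Finset.univ.filter fun v => iterLabel H E₁ E₀ tb n v = some true) := by
      ext; simp
    rw [e, Set.ncard_coe_finset]
    have h : (Finset.univ.filter fun v => iterLabel H E₁ E₀ tb n v = some true).card
        + Wc.card = n := by
      rw [hWc, Finset.card_filter_add_card_filter_not, Finset.card_univ, Fintype.card_fin]
    have : 2 * Wc.card < n := by exact_mod_cast hgoal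
    omega
  by_cases hP : ∀ v, InP nI nJ nO nP v →
      θ * n ≤ kernelDelta nI nJ nO nP (edgeProb nI nJ nO nP δ ε₁ ε₂) E₁ E₀ v
  · -- `P` is labeled `1`.
    have hbP := hbadcard (fun v => InP nI nJ nO nP v) (fun v hv => by omega) hP
    have hsub : Wc ⊆ (Finset.univ.filter fun v => InI nI v) ∪
        (Dblock ∪ (E₀ ∪ (bad JO ∪ bad fun v => InP nI nJ nO nP v))) := by
      intro v hv
      by_contra hcon
      simp only [Finset.mem_union, not_or, hDb] at hcon
      obtain ⟨hI, hDv, h0, hbJ, hbP⟩ := hcon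
      simp only [Finset.mem_filter, Finset.mem_univ, true_and] at hI hDv
      refine (Finset.mem_filter.1 hv).2 (hend v ?_)
      by_cases hPv : InP nI nJ nO nP v
      · exact hgood (fun v => InP nI nJ nO nP v) v hPv h0 hbP
      · exact hgood JO v (by simp only [hJOdef]; omega) h0 hbJ
    have hIcard : ((Finset.univ.filter fun v : Fin n => InI nI v).card : ℝ) = a * n := by
      rw [card_block (x := 0) (y := nI) (by have := hs.le_n; omega) (fun v => by simp [InI]),
        ← hs.I_eq]
      simp
    have hle : (Wc.card : ℝ) ≤ a * n + (d * n + (b * n + (τ * n + τ * n))) := by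
      linarith [card_le_of_subset_union hsub]
    linarith [mul_lt_mul_of_pos_right hsmall hN]
  · -- `I` is labeled `1`, and `J ∩ E₀` is small.
    push Not at hP
    obtain ⟨v', hv', hv'θ⟩ := hP
    have hI : ∀ v, InI nI v →
        θ * n ≤ kernelDelta nI nJ nO nP (edgeProb nI nJ nO nP δ ε₁ ε₂) E₁ E₀ v := by
      intro v hv
      linarith [hsIP v v' hv hv']
    have hbI := hbadcard (fun v => InI nI v) (fun v hv => by omega) hI
    have hj : (j₀ : ℝ) / 2 < θ * n + b * n - ρ * (a * n - d₁) := by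
      have e1 := mul_card_sub_le_sum (c := ρ) (A := fun w => InD nI nJ nO nP w) (hk0 v')
        (fun w hw => by
          rw [hk, hkval]
          rw [if_neg (by omega)]
          split_ifs <;> linarith) E₁
      have e0 := sum_le_card_sub (A := fun w => InJ nI nJ w) (hk1 v')
        (fun w hw => by
          rw [hk, hkval]
          split_ifs <;> first | (exfalso; omega) | norm_num) E₀
      unfold kernelDelta at hv'θ
      rw [← hk] at hv'θ
      rw [hE₁] at e1
      rw [hE₀] at e0
      linarith
    have hm : ∀ v : Fin n, ∃ u : Fin n, InD nI nJ nO nP v → (InJ nI nJ u ∧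
        (u : ℕ) = nI + ((v : ℕ) - (nI + nJ + nO + nP)) ∧ H.neighborSet v = {u}) := by
      intro v
      by_cases hv : InD nI nJ nO nP v
      · obtain ⟨u, hu⟩ := exists_pendant_neighbour hs ω hv
        exact ⟨u, fun _ => hu⟩
      · exact ⟨v, fun h => absurd h hv⟩
    choose m hm using hm
    set D' : Finset (Fin n) := Dblock.filter fun v => v ∉ E₁ ∧ v ∉ E₀ ∧
      ¬ iterLabel H E₁ E₀ tb 1 (m v) = some true with hD'
    have hD'1 : (D'.card : ℝ) ≤ d * n - d₁ := by
      have hdis : Disjoint D' (E₁.filter fun w => InD nI nJ nO nP w) := by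
        rw [Finset.disjoint_left]
        intro v hv hv1
        exact (Finset.mem_filter.1 hv).2.1 (Finset.mem_filter.1 hv1).1
      have hsub : D' ∪ (E₁.filter fun w => InD nI nJ nO nP w) ⊆ Dblock := by
        refine Finset.union_subset (Finset.filter_subset _ _) fun v hv => ?_
        exact Finset.mem_filter.2 ⟨Finset.mem_univ _, (Finset.mem_filter.1 hv).2⟩
      have h := Finset.card_le_card hsub
      rw [Finset.card_union_of_disjoint hdis] at h
      have h' : (D'.card : ℝ) + d₁ ≤ Dblock.card := by exact_mod_cast h
      linarith
    have hD'2 : (D'.card : ℝ) ≤ j₀ + τ * n := by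
      have h : D'.card ≤ ((E₀.filter fun w => InJ nI nJ w) ∪ bad JO).card := by
        refine Finset.card_le_card_of_injOn m ?_ ?_
        · intro v hv
          obtain ⟨hvD, -, -, hv⟩ := Finset.mem_filter.1 hv
          obtain ⟨hu, -, -⟩ := hm v (Finset.mem_filter.1 hvD).2
          by_contra hcon
          rw [Finset.mem_coe, Finset.mem_union, not_or] at hcon
          exact hv (hgood JO (m v) (Or.inl hu)
            (fun h => hcon.1 (Finset.mem_filter.2 ⟨h, hu⟩)) hcon.2)
        · intro v hv w hw hvw
          have hvD := (Finset.mem_filter.1 (Finset.mem_filter.1 hv).1).2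
          have hwD := (Finset.mem_filter.1 (Finset.mem_filter.1 hw).1).2
          have e1 := (hm v hvD).2.1
          have e2 := (hm w hwD).2.1
          rw [hvw] at e1
          exact Fin.ext (by omega)
      have h' : (D'.card : ℝ) ≤ j₀ + (bad JO).card := by
        exact_mod_cast h.trans (Finset.card_union_le _ _)
      linarith
    have hsub : Wc ⊆ (Finset.univ.filter fun v => InP nI nJ nO nP v) ∪
        (D' ∪ (E₀ ∪ (bad JO ∪ bad fun v => InI nI v))) := by
      intro v hv
      by_contra hcon
      simp only [Finset.mem_union, not_or] at hcon
      obtain ⟨hPv, hDv, h0, hbJ, hbI⟩ := hcon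
      simp only [Finset.mem_filter, Finset.mem_univ, true_and] at hPv
      refine (Finset.mem_filter.1 hv).2 ?_
      by_cases hDD : InD nI nJ nO nP v
      · by_cases h1 : v ∈ E₁
        · exact iterLabel_mono H E₁ E₀ tb (Nat.zero_le n) (by simp [iterLabel, h1])
        have hmv : iterLabel H E₁ E₀ tb 1 (m v) = some true := by
          by_contra hmv
          exact hDv (Finset.mem_filter.2
            ⟨Finset.mem_filter.2 ⟨Finset.mem_univ _, hDD⟩, h1, h0, hmv⟩)
        exact iterLabel_mono H E₁ E₀ tb hn
          (iterLabel_two_of_pendant H tb h1 h0 (hm v hDD).2.2 hmv)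
      · refine hend v ?_
        by_cases hIv : InI nI v
        · exact hgood (fun v => InI nI v) v hIv h0 hbI
        · exact hgood JO v (by simp only [hJOdef]; omega) h0 hbJ
    have hPcard : ((Finset.univ.filter fun v : Fin n => InP nI nJ nO nP v).card : ℝ) = nP := by
      rw [card_block (x := nI + nJ + nO) (y := nI + nJ + nO + nP) hs.le_n (fun v => Iff.rfl)]
      simp
    have hle : (Wc.card : ℝ) ≤ nP + (D'.card + (b * n + (τ * n + τ * n))) := by
      linarith [card_le_of_subset_union hsub]
    have hPe := hs.P_eq
    have hτn : 0 < τ * n := by positivity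
    rcases lt_or_ge ((d / 2 + 4 * τ) * n) d₁ with hcase | hcase
    · linarith
    · have h3 : ρ * d₁ ≤ ρ * ((d / 2 + 4 * τ) * n) := mul_le_mul_of_nonneg_left hcase hρ0
      have h4 : (2 * (θ + b - ρ * a) + ρ * (d + 8 * τ)) * n ≤ (d / 2 - 4 * τ) * n :=
        mul_le_mul_of_nonneg_right hD hN.le
      linarith

end Deterministic

/-! ### Probability of low noise -/

instance (n nI nJ nO nP : ℕ) (δ ε₁ ε₂ : ℝ) :
    IsProbabilityMeasure (edgeMeasure n nI nJ nO nP δ ε₁ ε₂) := by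
  unfold edgeMeasure; infer_instance

instance (n : ℕ) : IsProbabilityMeasure (coinMeasure n) := by
  unfold coinMeasure; infer_instance

instance (n : ℕ) : IsProbabilityMeasure (tieMeasure n) := by
  unfold tieMeasure; infer_instance

section Probability

variable {nI nJ nO nP n : ℕ} {δ ε₁ ε₂ ρ : ℝ}

lemma edgeProb_mem_Icc (h1 : (1 / 2 - δ) / (1 / 2 + δ) + ε₁ = 1 / 2)
    (h2 : (1 / 2 - δ) / (1 / 2 + δ) - ε₂ = ρ) (hρ0 : 0 ≤ ρ) (hρ1 : ρ ≤ 1 / 2) (v w : Fin n) :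
    edgeProb nI nJ nO nP δ ε₁ ε₂ v w ∈ Set.Icc (0 : ℝ) 1 := by
  unfold edgeProb
  rw [h1, h2]
  split_ifs <;> constructor <;> linarith

lemma measureReal_not_lowNoise_le {p : Fin n → Fin n → ℝ} (hp0 : ∀ v w, 0 ≤ p v w)
    (hp1 : ∀ v w, p v w ≤ 1) {η : ℝ} (hη : 0 ≤ η) (hn : 0 < n) :
    (Measure.pi fun v => Measure.pi fun w => bern (p v w)).real
      {ω | ¬ LowNoise nI nJ nO nP p η ω} ≤ 8 ^ n * Real.exp (-(η ^ 2 / 2 * (n : ℝ) ^ 2)) := by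
  have hN : (0 : ℝ) < n := by exact_mod_cast hn
  set bad : Finset (Fin n) × Finset (Fin n) × Finset (Fin n) → Set (Fin n → Fin n → Bool) :=
    fun x => {ω | η * (n : ℝ) ^ 2 ≤ ∑ v, ∑ w, -noiseWeight nI nJ nO nP x.1 x.2.1 x.2.2 v w *
      ((if ω v w = true then (1 : ℝ) else 0) - p v w)} with hbad
  have hsub : {ω | ¬ LowNoise nI nJ nO nP p η ω} ⊆ ⋃ x, bad x := by
    intro ω hω
    simp only [Set.mem_ofPred_eq, LowNoise] at hω
    push Not at hω
    obtain ⟨S, E₁, E₀, h⟩ := hω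
    refine Set.mem_iUnion.2 ⟨(S, E₁, E₀), ?_⟩
    simp only [hbad, Set.mem_ofPred_eq, neg_mul, Finset.sum_neg_distrib]
    simp only [bitVal] at h
    linarith
  have hV : ∀ x : Finset (Fin n) × Finset (Fin n) × Finset (Fin n),
      ∑ v, ∑ w, (-noiseWeight nI nJ nO nP x.1 x.2.1 x.2.2 v w) ^ 2 ≤ 4 * (n : ℝ) ^ 2 := by
    intro x
    calc ∑ v, ∑ w, (-noiseWeight nI nJ nO nP x.1 x.2.1 x.2.2 v w) ^ 2
        ≤ ∑ _v : Fin n, ∑ _w : Fin n, (4 : ℝ) := by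
          gcongr
          rw [neg_sq]
          exact noiseWeight_sq_le ..
      _ = 4 * (n : ℝ) ^ 2 := by simp; ring
  refine (measureReal_mono hsub).trans ((measureReal_iUnion_fintype_le _).trans ?_)
  calc _ ≤ ∑ _x : Finset (Fin n) × Finset (Fin n) × Finset (Fin n),
        Real.exp (-(η ^ 2 / 2 * (n : ℝ) ^ 2)) := by
        refine Finset.sum_le_sum fun x _ => ?_
        refine (measure_weighted_sum_ge_le p hp0 hp1 _ (by positivity) (by positivity)
          (hV x)).trans_eq ?_
        congr 1
        field_simp
        ring
    _ = _ := by
        have h8 : (8 : ℝ) ^ n = 2 ^ n * (2 ^ n * 2 ^ n) := by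
          rw [← mul_pow, ← mul_pow]; norm_num
        simp [h8]

lemma tendsto_pow_mul_exp_neg_sq {c : ℝ} (hc : 0 < c) :
    Tendsto (fun n : ℕ => (8 : ℝ) ^ n * Real.exp (-(c * (n : ℝ) ^ 2))) atTop (nhds 0) := by
  have h : (fun n : ℕ => (8 : ℝ) ^ n * Real.exp (-(c * (n : ℝ) ^ 2)))
      = fun n : ℕ => Real.exp (n * (Real.log 8 - c * n)) := by
    ext n
    rw [← Real.exp_log (by norm_num : (0 : ℝ) < 8), ← Real.exp_nat_mul, ← Real.exp_add,
      Real.exp_log (by norm_num : (0 : ℝ) < 8)]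
    congr 1
    ring
  rw [h]
  refine Real.tendsto_exp_atBot.comp (tendsto_natCast_atTop_atTop.atTop_mul_atBot₀ ?_)
  exact tendsto_atBot_add_const_left _ _
    (tendsto_neg_atTop_atBot.comp (tendsto_natCast_atTop_atTop.const_mul_atTop hc))

lemma tendsto_mul_exp_neg {c : ℝ} (hc : 0 < c) :
    Tendsto (fun n : ℕ => (n : ℝ) * Real.exp (-(c * n))) atTop (nhds 0) := by
  have h := ((Real.tendsto_pow_mul_exp_neg_atTop_nhds_zero 1).comp
    (tendsto_natCast_atTop_atTop (R := ℝ).const_mul_atTop hc)).div_const c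
  rw [zero_div] at h
  refine h.congr fun n => ?_
  simp only [Function.comp, pow_one]
  field_simp

lemma sizes_of_admissible {μ d : ℝ} {sI sJ sO sP sD : ℕ → ℕ}
    (h : AdmissibleSizes μ δ d sI sJ sO sP sD n) :
    Sizes (sI n) (sJ n) (sO n) (sP n) n (μ * (1 / 2 + δ)) (μ * (1 / 2 - δ)) d := by
  obtain ⟨hsum, hDJ, hI, hO, -, hOP, hD⟩ := h
  refine ⟨by omega, by omega, hI, by linarith, ?_⟩
  rw [← hD]
  exact_mod_cast hsum.symm

theorem robustIter {μ d θ τ : ℝ} (h1 : (1 / 2 - δ) / (1 / 2 + δ) + ε₁ = 1 / 2)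
    (h2 : (1 / 2 - δ) / (1 / 2 + δ) - ε₂ = ρ) (hρ0 : 0 ≤ ρ) (hρ1 : ρ ≤ 1 / 2)
    (hθ : 0 < θ) (hτ : 0 < τ)
    (hJO : 2 * θ ≤ μ * (1 / 2 + δ) - d - 2 * (μ * (1 / 2 - δ)))
    (hsmall : μ * (1 / 2 + δ) + μ * (1 / 2 - δ) + d + 3 * τ < 1 / 2)
    (hD : 2 * (θ + μ * (1 / 2 - δ) - ρ * (μ * (1 / 2 + δ))) + ρ * (d + 8 * τ) ≤ d / 2 - 4 * τ)
    (sI sJ sO sP sD : ℕ → ℕ) : RobustIter μ δ ε₁ ε₂ d sI sJ sO sP sD := by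
  obtain ⟨η, hη0, hθτ⟩ : ∃ η, 0 < η ∧ θ * τ = 2 * η := ⟨θ * τ / 2, by positivity, by ring⟩
  have hlim : Tendsto (fun n : ℕ =>
      1 - ENNReal.ofReal (8 ^ n * Real.exp (-(η ^ 2 / 2 * (n : ℝ) ^ 2)))) atTop (nhds 1) := by
    have h := ENNReal.tendsto_ofReal (tendsto_pow_mul_exp_neg_sq (c := η ^ 2 / 2) (by positivity))
    simpa using ENNReal.Tendsto.sub tendsto_const_nhds h (Or.inl ENNReal.one_ne_top)
  have hlarge : ∀ᶠ n : ℕ in atTop, 1 ≤ η * n :=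
    (tendsto_natCast_atTop_atTop.const_mul_atTop hη0).eventually_ge_atTop 1
  refine tendsto_of_tendsto_of_tendsto_of_le_of_le' (hlim.mono_left inf_le_left)
    tendsto_const_nhds ?_ (Eventually.of_forall fun n => prob_le_one)
  rw [eventually_inf_principal]
  filter_upwards [hlarge, eventually_ge_atTop 2] with n hn hn2 hadm
  set A := {ω : Fin n → Fin n → Bool | LowNoise (sI n) (sJ n) (sO n) (sP n)
    (edgeProb (sI n) (sJ n) (sO n) (sP n) δ ε₁ ε₂) η ω} with hA
  have hmem := edgeProb_mem_Icc (n := n) (nI := sI n) (nJ := sJ n) (nO := sO n) (nP := sP n)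
    h1 h2 hρ0 hρ1
  have hsub : A ×ˢ Set.univ ⊆ {ω | IterMajority μ δ n (sI n) (sJ n) (sO n) (sP n) ω} := by
    rintro ⟨ω, T⟩ ⟨hω, -⟩ E₁ E₀ hE hE₁ hE₀
    exact iterMajority_of_lowNoise (sizes_of_admissible hadm) h1 h2 hρ0 hρ1 hn2 hθ hJO hsmall hτ
      hD (by rw [hθτ]; linarith) hω hE (by rw [hE₁]; ring) (by rw [hE₀]; ring) _
  refine le_trans ?_ (measure_mono hsub)
  rw [Measure.prod_prod, measure_univ, mul_one,
    ← compl_compl A, prob_compl_eq_one_sub (Set.toFinite _).measurableSet]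
  refine tsub_le_tsub_left ?_ _
  rw [ENNReal.le_ofReal_iff_toReal_le (measure_ne_top _ _) (by positivity)]
  exact measureReal_not_lowNoise_le (fun v w => (hmem v w).1) (fun v w => (hmem v w).2)
    hη0.le (by omega)

/-! ### The non-iterative dissemination -/

lemma card_Iset (h : nI ≤ n) : (Iset nI n).card = nI := by
  rw [Iset, card_block (x := 0) (y := nI) h fun v => by simp [InI]]
  simp

lemma card_Oset (h : nI + nJ + nO ≤ n) : (Oset nI nJ nO n).card = nO := by
  rw [Oset, card_block (x := nI + nJ) (y := nI + nJ + nO) h fun v => Iff.rfl]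
  simp

/-- With the experts on `I` and `O`, a vertex of `P` with few neighbours in `I` is misled. -/
lemma Delta_neg_of_inP (hle : nI + nJ + nO + nP ≤ n) (ω : Fin n → Fin n → Bool) {v : Fin n}
    (hv : InP nI nJ nO nP v) (h : ∑ w ∈ Iset nI n, bitVal ω w v < nO) :
    Delta (blockGraph nI nJ nO nP ω) (Iset nI n) (Oset nI nJ nO n) v < 0 := by
  classical
  have e1 : ∑ w ∈ Iset nI n, (if (blockGraph nI nJ nO nP ω).Adj v w then (1 : ℝ) else 0)
      = ∑ w ∈ Iset nI n, bitVal ω w v := by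
    refine Finset.sum_congr rfl fun w hw => ?_
    replace hw : InI nI w := (Finset.mem_filter.1 hw).2
    rw [kernel_eq_adj ω (by rintro rfl; omega) (by omega) (by omega), kernel,
      if_neg (by omega), if_pos (by omega)]
  have e0 : ∑ w ∈ Oset nI nJ nO n,
      (if (blockGraph nI nJ nO nP ω).Adj v w then (1 : ℝ) else 0) = nO := by
    have h1 : ∑ w ∈ Oset nI nJ nO n, (1 : ℝ) = nO := by
      rw [Finset.sum_const, card_Oset (by omega), nsmul_one]
    rw [← h1]
    refine Finset.sum_congr rfl fun w hw => ?_
    replace hw : InO nI nJ nO w := (Finset.mem_filter.1 hw).2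
    rw [kernel_eq_adj ω (by rintro rfl; omega) (by omega) (by omega), kernel,
      if_neg (by omega), if_neg (by omega), if_neg (by omega)]
  rw [← Int.cast_lt (R := ℝ), Delta, Int.cast_sub, ncard_neighborSet_inter,
    ncard_neighborSet_inter, e1, e0, Int.cast_zero]
  linarith

lemma Delta_eq_zero_of_inD {a b d : ℝ} (hs : Sizes nI nJ nO nP n a b d)
    (ω : Fin n → Fin n → Bool) {v : Fin n} (hv : InD nI nJ nO nP v) :
    Delta (blockGraph nI nJ nO nP ω) (Iset nI n) (Oset nI nJ nO n) v = 0 := by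
  obtain ⟨u, hu, -, hN⟩ := exists_pendant_neighbour hs ω hv
  have hI : u ∉ Iset nI n := by simp only [Iset, Finset.mem_filter]; omega
  have hO : u ∉ Oset nI nJ nO n := by simp only [Oset, Finset.mem_filter]; omega
  have hE : ∀ E : Finset (Fin n), u ∉ E → ({u} ∩ (E : Set (Fin n))) = ∅ := by
    intro E hE
    simpa using hE
  rw [Delta, hN, hE _ hI, hE _ hO]
  simp

/-- With the experts on `I` and `O`, the label `1` has no majority if `P` is misled and at most
half of the coins on `D` show `1`. -/
lemma card_labelNonIter_le {a b d : ℝ} (hs : Sizes nI nJ nO nP n a b d)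
    (hIJ : 2 * (nI + nJ) + (Dset nI nJ nO nP n).card = n) {ω : Fin n → Fin n → Bool}
    (hω : ∀ v ∈ Pset nI nJ nO nP n, ∑ w ∈ Iset nI n, bitVal ω w v < nO) {c : Fin n → Bool}
    (hc : 2 * ((Dset nI nJ nO nP n).filter fun v => c v = true).card
      ≤ (Dset nI nJ nO nP n).card) :
    2 * {v : Fin n | labelNonIter (blockGraph nI nJ nO nP ω) (Iset nI n) (Oset nI nJ nO n) c v
      = true}.ncard ≤ n := by
  classical
  have hle := hs.le_n
  set IJ : Finset (Fin n) := Finset.univ.filter fun v => (v : ℕ) < nI + nJ with hIJdef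
  have hIJcard : IJ.card = nI + nJ := by
    rw [hIJdef, card_block (x := 0) (y := nI + nJ) (by omega) fun v => by simp]
    simp
  have hsub : {v : Fin n | labelNonIter (blockGraph nI nJ nO nP ω) (Iset nI n)
      (Oset nI nJ nO n) c v = true}
      ⊆ ↑(IJ ∪ (Dset nI nJ nO nP n).filter fun v => c v = true) := by
    intro v hv
    rw [Finset.mem_coe, Finset.mem_union]
    by_cases hvIJ : (v : ℕ) < nI + nJ
    · exact .inl (Finset.mem_filter.2 ⟨Finset.mem_univ _, hvIJ⟩)
    have hvI : v ∉ Iset nI n := by simp only [Iset, Finset.mem_filter]; omega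
    by_cases hvO : v ∈ Oset nI nJ nO n
    · simp [labelNonIter, hvI, hvO] at hv
    by_cases hvP : InP nI nJ nO nP v
    · have hneg := Delta_neg_of_inP hle ω hvP
        (hω v (Finset.mem_filter.2 ⟨Finset.mem_univ _, hvP⟩))
      simp [labelNonIter, hvI, hvO, hneg.not_gt, hneg.not_ge] at hv
    · have hvD : InD nI nJ nO nP v := by
        simp only [Oset, Finset.mem_filter, Finset.mem_univ, true_and] at hvO
        omega
      have hzero := Delta_eq_zero_of_inD hs ω hvD
      refine .inr (Finset.mem_filter.2 ⟨Finset.mem_filter.2 ⟨Finset.mem_univ _, hvD⟩, ?_⟩)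
      simpa [labelNonIter, hvI, hvO, hzero] using hv
  have h1 := Set.ncard_le_ncard hsub (Finset.finite_toSet _)
  rw [Set.ncard_coe_finset] at h1
  have h2 := Finset.card_union_le IJ ((Dset nI nJ nO nP n).filter fun v => c v = true)
  omega

lemma measureReal_exists_inP_le (hp0 : ∀ v w : Fin n, 0 ≤ edgeProb nI nJ nO nP δ ε₁ ε₂ v w)
    (hp1 : ∀ v w : Fin n, edgeProb nI nJ nO nP δ ε₁ ε₂ v w ≤ 1)
    (h2 : (1 / 2 - δ) / (1 / 2 + δ) - ε₂ = ρ) (hn : 0 < n) (hI : nI ≤ n) {c : ℝ} (hc : 0 ≤ c)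
    (hnO : (nO : ℝ) = ρ * nI + c * n) :
    (edgeMeasure n nI nJ nO nP δ ε₁ ε₂).real
      {ω | ¬ ∀ v ∈ Pset nI nJ nO nP n, ∑ w ∈ Iset nI n, bitVal ω w v < nO}
      ≤ n * Real.exp (-(2 * c ^ 2 * n)) := by
  have hN : (0 : ℝ) < n := by exact_mod_cast hn
  set s : Fin n → Fin n → Fin n → ℝ := fun v x y =>
    if y = v then (if x ∈ Iset nI n then 1 else 0) else 0 with hs
  set bad : Fin n → Set (Fin n → Fin n → Bool) := fun v =>
    {ω | c * n ≤ ∑ x, ∑ y, s v x y * ((if ω x y = true then (1 : ℝ) else 0)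
      - edgeProb nI nJ nO nP δ ε₁ ε₂ x y)} with hbad
  have hsub : {ω | ¬ ∀ v ∈ Pset nI nJ nO nP n, ∑ w ∈ Iset nI n, bitVal ω w v < nO}
      ⊆ ⋃ v ∈ Pset nI nJ nO nP n, bad v := by
    intro ω hω
    rw [Set.mem_ofPred_eq] at hω
    push Not at hω
    obtain ⟨v, hv, h⟩ := hω
    refine Set.mem_biUnion hv ?_
    have hvP : InP nI nJ nO nP v := (Finset.mem_filter.1 hv).2
    have e : ∑ x ∈ Iset nI n, edgeProb nI nJ nO nP δ ε₁ ε₂ x v = nI * ρ := by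
      rw [Finset.sum_congr rfl (g := fun _ => ρ), Finset.sum_const, card_Iset hI, nsmul_eq_mul]
      intro x hx
      have hxI : InI nI x := (Finset.mem_filter.1 hx).2
      rw [edgeProb, if_neg (by omega), if_neg (by omega), if_pos ⟨hxI, hvP⟩, h2]
    simp only [hbad, hs, Set.mem_ofPred_eq, ite_mul, one_mul, zero_mul, Finset.sum_ite_eq',
      Finset.mem_univ, if_true, Finset.sum_ite_mem, Finset.univ_inter, Finset.sum_sub_distrib, e]
    simp only [bitVal] at h
    linarith
  have hV : ∀ v, ∑ x, ∑ y, s v x y ^ 2 ≤ (n : ℝ) := by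
    intro v
    calc ∑ x, ∑ y, s v x y ^ 2 ≤ ∑ _x : Fin n, (1 : ℝ) := by
          refine Finset.sum_le_sum fun x _ => ?_
          rw [Finset.sum_eq_single v (fun y _ hy => by simp [hs, hy]) (by simp)]
          simp only [hs, if_true]
          split_ifs <;> norm_num
      _ = n := by simp
  refine (measureReal_mono hsub (measure_ne_top _ _)).trans
    ((measureReal_biUnion_finset_le _ _).trans ?_)
  calc _ ≤ ∑ _v ∈ Pset nI nJ nO nP n, Real.exp (-(2 * c ^ 2 * n)) := by
        refine Finset.sum_le_sum fun v _ => ?_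
        refine (measure_weighted_sum_ge_le _ hp0 hp1 (s v) (by positivity) hN (hV v)).trans_eq ?_
        congr 1
        field_simp
    _ ≤ _ := by
        rw [Finset.sum_const, nsmul_eq_mul]
        gcongr
        exact (Finset.card_le_univ _).trans_eq (Fintype.card_fin n)

theorem not_robustNonIter {μ d c : ℝ} (h1 : (1 / 2 - δ) / (1 / 2 + δ) + ε₁ = 1 / 2)
    (h2 : (1 / 2 - δ) / (1 / 2 + δ) - ε₂ = ρ) (hρ0 : 0 ≤ ρ) (hρ1 : ρ ≤ 1 / 2) (hc : 0 < c)
    (hcμ : μ * (1 / 2 - δ) = ρ * (μ * (1 / 2 + δ)) + c) {sI sJ sO sP sD : ℕ → ℕ}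
    (hinf : {n | AdmissibleSizes μ δ d sI sJ sO sP sD n}.Infinite) :
    ¬ RobustNonIter μ δ ε₁ ε₂ d sI sJ sO sP sD := by
  intro hrob
  have : (atTop ⊓ 𝓟 {n | AdmissibleSizes μ δ d sI sJ sO sP sD n}).NeBot :=
    frequently_mem_iff_neBot.1 (Nat.frequently_atTop_iff_infinite.2 hinf)
  have hlim : Tendsto (fun n : ℕ =>
      ENNReal.ofReal (n * Real.exp (-(2 * c ^ 2 * n))) + 1 / 2) atTop (nhds (1 / 2)) := by
    have h := ENNReal.tendsto_ofReal (tendsto_mul_exp_neg (c := 2 * c ^ 2) (by positivity))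
    simpa using h.add_const (1 / 2 : ENNReal)
  refine absurd (le_of_tendsto_of_tendsto hrob (hlim.mono_left inf_le_left) ?_)
    (not_le.2 (by rw [one_div]; exact ENNReal.one_half_lt_one))
  rw [EventuallyLE, eventually_inf_principal]
  filter_upwards [eventually_gt_atTop 0] with n hn hadm
  have hs := sizes_of_admissible hadm
  obtain ⟨hsum, -, hI, hO, hIJ, hOP, hD⟩ := hadm
  have hmem := edgeProb_mem_Icc (n := n) (nI := sI n) (nJ := sJ n) (nO := sO n) (nP := sP n)
    h1 h2 hρ0 hρ1
  have hDcard : (Dset (sI n) (sJ n) (sO n) (sP n) n).card = sD n := by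
    rw [Dset, card_block (x := sI n + sJ n + sO n + sP n) le_rfl fun v => by simp [InD]]
    omega
  have hIJ' : 2 * (sI n + sJ n) + (Dset (sI n) (sJ n) (sO n) (sP n) n).card = n := by
    rw [hDcard, ← Nat.cast_inj (R := ℝ)]
    push_cast
    linarith
  set B := {ω : Fin n → Fin n → Bool | ¬ ∀ v ∈ Pset (sI n) (sJ n) (sO n) (sP n) n,
    ∑ w ∈ Iset (sI n) n, bitVal ω w v < sO n} with hB
  set C := {c : Fin n → Bool | (Dset (sI n) (sJ n) (sO n) (sP n) n).card <
    2 * ((Dset (sI n) (sJ n) (sO n) (sP n) n).filter fun v => c v = true).card} with hC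
  have hsub : {ω | NonIterMajority μ δ n (sI n) (sJ n) (sO n) (sP n) ω}
      ⊆ B ×ˢ Set.univ ∪ Set.univ ×ˢ C := by
    rintro ⟨ω, T⟩ hω
    by_contra hcon
    simp only [hB, hC, Set.mem_union, Set.mem_prod, Set.mem_univ, and_true, true_and, not_or,
      Set.mem_ofPred_eq, not_not, not_lt] at hcon
    refine absurd (hω (Iset (sI n) n) (Oset (sI n) (sJ n) (sO n) n) ?_ ?_ ?_)
      (not_lt.2 (card_labelNonIter_le hs hIJ' hcon.1 hcon.2))
    · rw [Finset.disjoint_left]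
      intro v hv hv'
      simp only [Iset, Oset, Finset.mem_filter] at hv hv'
      omega
    · rw [card_Iset (by omega), hI]; ring
    · rw [card_Oset (by omega), hO]; ring
  refine (measure_mono hsub).trans ((measure_union_le _ _).trans ?_)
  rw [Measure.prod_prod, Measure.prod_prod, measure_univ, measure_univ, mul_one, one_mul]
  refine add_le_add ?_ (coinMeasure_majority_le _)
  rw [ENNReal.le_ofReal_iff_toReal_le (measure_ne_top _ _) (by positivity)]
  refine measureReal_exists_inP_le (fun v w => (hmem v w).1) (fun v w => (hmem v w).2) h2 hn
    (by omega) hc.le ?_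
  rw [hO, hI, hcμ]
  ring

end Probability

/-- **Iterativity can harm the strong adversary** (refuting the conjecture of
Alon, Feldman, Mansour, Oren and Tennenholtz). For all `0 < μ < 1/2` and
`1/6 < δ < 1/2` there are `ε₁, ε₂, d > 0` such that the graph sequence
`G = G_n` is, with high probability, robust against the iterative strong
adversary but not robust against the non-iterative strong adversary. -/
theorem iterativity_harms_adversary (μ δ : ℝ) (hμ0 : 0 < μ) (hμ1 : μ < 1 / 2)
    (hδ0 : 1 / 6 < δ) (hδ1 : δ < 1 / 2) :
    ∃ ε₁ : ℝ, 0 < ε₁ ∧ ∃ ε₂ : ℝ, 0 < ε₂ ∧ ∃ d : ℝ, 0 < d ∧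
      ∀ sI sJ sO sP sD : ℕ → ℕ,
        {n | AdmissibleSizes μ δ d sI sJ sO sP sD n}.Infinite →
        RobustIter μ δ ε₁ ε₂ d sI sJ sO sP sD ∧
        ¬ RobustNonIter μ δ ε₁ ε₂ d sI sJ sO sP sD := by
  have hq : 0 < 1 / 2 + δ := by linarith
  obtain ⟨r, hr⟩ : ∃ r, r = (1 / 2 - δ) / (1 / 2 + δ) := ⟨_, rfl⟩
  have hr0 : 0 < r := by rw [hr]; exact div_pos (by linarith) hq
  have hr1 : r < 1 / 2 := by rw [hr, div_lt_iff₀ hq]; linarith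
  obtain ⟨a, ha⟩ : ∃ a, a = μ * (1 / 2 + δ) := ⟨_, rfl⟩
  have ha0 : 0 < a := by rw [ha]; positivity
  have hb : μ * (1 / 2 - δ) = r * a := by rw [hr, ha]; field_simp
  have hab : a + r * a = μ := by rw [← hb, ha]; ring
  have ha1 : a ≤ 1 := by nlinarith
  obtain ⟨κ, hκ⟩ : ∃ κ, κ = 1 - 2 * r := ⟨_, rfl⟩
  have hκ0 : 0 < κ := by linarith
  obtain ⟨d, hd⟩ : ∃ d, d = min (κ * a / 2) ((1 / 2 - μ) / 2) := ⟨_, rfl⟩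
  have hd0 : 0 < d := by rw [hd]; exact lt_min (by positivity) (by linarith)
  have hd1 : d ≤ κ * a / 2 := hd ▸ min_le_left _ _
  have hd2 : d ≤ (1 / 2 - μ) / 2 := hd ▸ min_le_right _ _
  obtain ⟨ε, hε⟩ : ∃ ε, ε = min (r / 2) (κ * d / 16) := ⟨_, rfl⟩
  have hκd : 0 < κ * d := by positivity
  have hε0 : 0 < ε := by rw [hε]; exact lt_min (by positivity) (by positivity)
  have hε1 : ε ≤ r / 2 := hε ▸ min_le_left _ _
  have hε2 : ε ≤ κ * d / 16 := hε ▸ min_le_right _ _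
  have hκd1 : κ * d ≤ d := mul_le_of_le_one_left hd0.le (by linarith)
  have hεa : ε * a ≤ κ * d / 16 := (mul_le_of_le_one_right hε0.le ha1).trans hε2
  have h1 : (1 / 2 - δ) / (1 / 2 + δ) + (1 / 2 - r) = 1 / 2 := by rw [← hr]; ring
  have h2 : (1 / 2 - δ) / (1 / 2 + δ) - ε = r - ε := by rw [← hr]
  refine ⟨1 / 2 - r, by linarith, ε, hε0, d, hd0, fun sI sJ sO sP sD hinf => ⟨?_, ?_⟩⟩
  · refine robustIter (θ := κ * d / 16) (τ := κ * d / 64) h1 h2 (by linarith) (by linarith)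
      (by positivity) (by positivity) ?_ ?_ ?_ sI sJ sO sP sD <;> rw [hb, ← ha]
    · have : κ * a = a - 2 * (r * a) := by rw [hκ]; ring
      linarith
    · linarith
    · have e1 : κ * d = d - 2 * (r * d) := by rw [hκ]; ring
      have e2 : (r - ε) * (d + 8 * (κ * d / 64)) ≤ r * d + κ * d / 8 := by
        have : (r - ε) * (d + 8 * (κ * d / 64)) ≤ r * (d + 8 * (κ * d / 64)) := by
          gcongr
          linarith
        have : r * (κ * d) ≤ κ * d := mul_le_of_le_one_left hκd.le (by linarith)
        linarith
      linarith
  · refine not_robustNonIter (c := ε * a) h1 h2 (by linarith) (by linarith) (by positivity) ?_ hinf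
    rw [hb, ← ha]
    ring

end AdversarialOpinion
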